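/- Let b : S → ℝ be a probability distribution on a nonempty finite set S (b(s) ≥ 0 for all s and Σ_s b(s) = 1), let s₀ ∈ S, let ε ∈ [0,1] with b(s₀) ≥ 1 − ε, and let α : S → ℝ be any function. Then |α(s₀) − Σ_s α(s) b(s)| ≤ ε · (max_s α(s) − min_s α(s)). -/

import Mathlib

open Finset

/-- If a probability distribution `b` on a nonempty finite set `S` puts mass at
least `1 − ε` on `s₀`, then for any `α : S → ℝ`,
`|α(s₀) − Σ_s α(s) b(s)| ≤ ε · (max_s α(s) − min_s α(s))`. -/
theorem concentrated_belief_expectation_close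
    {S : Type*} [Fintype S] [Nonempty S]
    (b : S → ℝ) (hb0 : ∀ s, 0 ≤ b s) (hb1 : ∑ s, b s = 1)
    (s₀ : S) (ε : ℝ) (hε0 : 0 ≤ ε) (hε1 : ε ≤ 1)
    (hconc : 1 - ε ≤ b s₀) (α : S → ℝ) :
    |α s₀ - ∑ s, α s * b s| ≤ ε * ((⨆ s : S, α s) - ⨅ s : S, α s) := by
  have hle : ∀ s, α s ≤ ⨆ s, α s := le_ciSup (Set.finite_range α).bddAbove
  have hge : ∀ s, ⨅ s, α s ≤ α s := ciInf_le (Set.finite_range α).bddBelow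
  generalize (⨆ s, α s) = M at *
  generalize (⨅ s, α s) = m at *
  have hM : (M - α s₀) * b s₀ ≤ M - ∑ s, α s * b s := by
    calc (M - α s₀) * b s₀ ≤ ∑ s, (M - α s) * b s :=
          Finset.single_le_sum (f := fun s => (M - α s) * b s)
            (fun s _ => mul_nonneg (sub_nonneg.2 (hle s)) (hb0 s)) (Finset.mem_univ s₀)
      _ = M - ∑ s, α s * b s := by
          simp only [sub_mul, Finset.sum_sub_distrib, ← Finset.mul_sum, hb1, mul_one]
  have hm : (α s₀ - m) * b s₀ ≤ ∑ s, α s * b s - m := by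
    calc (α s₀ - m) * b s₀ ≤ ∑ s, (α s - m) * b s :=
          Finset.single_le_sum (f := fun s => (α s - m) * b s)
            (fun s _ => mul_nonneg (sub_nonneg.2 (hge s)) (hb0 s)) (Finset.mem_univ s₀)
      _ = ∑ s, α s * b s - m := by
          simp only [sub_mul, Finset.sum_sub_distrib, ← Finset.mul_sum, hb1, mul_one]
  have h₁ := mul_le_mul_of_nonneg_left hconc (sub_nonneg.2 (hle s₀))
  have h₂ := mul_le_mul_of_nonneg_left hconc (sub_nonneg.2 (hge s₀))
  have h₃ := mul_le_mul_of_nonneg_left (hle s₀) hε0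
  have h₄ := mul_le_mul_of_nonneg_left (hge s₀) hε0
  rw [abs_le]
  constructor <;> linarith
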